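/- The condition p ≥ 2 is necessary in the modulation-space Rubio de Francia theorem: for each 1 < p < 2 and 1 ≤ q ≤ ∞, there exists a collection Ω of pairwise disjoint intervals in ℝ such that the Littlewood–Paley operator Δ_Ω is not bounded from M_{p,q}(ℝ) to M_{p,q}(ℓ²). -/

import Mathlib

open MeasureTheory Complex
open scoped ENNReal NNReal Real

noncomputable section

/-- Short-time Fourier transform on `ℝ`. -/
def STFT1 (g f : ℝ → ℂ) (x ξ : ℝ) : ℂ :=
  ∫ t : ℝ, Complex.exp (Complex.ofReal (-2 * Real.pi * (t * ξ)) * Complex.I) *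
    (starRingEnd ℂ) (g (t - x)) * f t

/-- Fourier transform on `ℝ`. -/
def fourier1 (f : ℝ → ℂ) (ξ : ℝ) : ℂ :=
  ∫ t : ℝ, Complex.exp (Complex.ofReal (-2 * Real.pi * (t * ξ)) * Complex.I) * f t

/-- Inverse Fourier transform on `ℝ`. -/
def fourierInv1 (f : ℝ → ℂ) (x : ℝ) : ℂ :=
  ∫ ξ : ℝ, Complex.exp (Complex.ofReal (2 * Real.pi * (x * ξ)) * Complex.I) * f ξ

/-- Fourier multiplier operator `T_σ f = (σ f̂)^∨` on `ℝ`. -/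
def mulOp1 (σ : ℝ → ℂ) (f : ℝ → ℂ) : ℝ → ℂ :=
  fourierInv1 (fun ξ => σ ξ * fourier1 f ξ)

/-- Modulation space norm `‖f‖_{M_{p,q}(ℝ)}` with window `g`. -/
def MNorm1 (p q : ℝ≥0∞) (g f : ℝ → ℂ) : ℝ≥0∞ :=
  eLpNorm (fun ξ : ℝ => (eLpNorm (fun x : ℝ => STFT1 g f x ξ) p volume).toReal) q volume

/-- `ℓ²(ℤ)`-valued modulation space norm with window `g`. -/
def Ml2Norm1 (p q : ℝ≥0∞) (g : ℝ → ℂ) (F : ℤ → ℝ → ℂ) : ℝ≥0∞ :=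
  eLpNorm (fun ξ : ℝ =>
    (eLpNorm (fun x : ℝ => Real.sqrt (∑' m : ℤ, ‖STFT1 g (F m) x ξ‖ ^ 2)) p volume).toReal)
    q volume

/-- The discrete (`ℓ^q(ℤ)` of `L^p`) mixed norm used in the equivalent definition of
modulation space norms. -/
def lqlpNorm (p q : ℝ≥0∞) (F : ℤ → ℝ → ℂ) : ℝ≥0∞ :=
  eLpNorm (fun k : ℤ => (eLpNorm (F k) p volume).toReal) q Measure.count

/-- The discrete (`ℓ^q(ℤ)` of `L^p`) mixed norm of an `ℓ²(ℤ)`-valued family. -/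
def lqlpl2Norm (p q : ℝ≥0∞) (F : ℤ → ℤ → ℝ → ℂ) : ℝ≥0∞ :=
  eLpNorm (fun k : ℤ =>
    (eLpNorm (fun x : ℝ => Real.sqrt (∑' m : ℤ, ‖F k m x‖ ^ 2)) p volume).toReal)
    q Measure.count

/-- The cutoff Fourier multiplier operator `S_ω` associated with the interval
`ω = [a, b)`. -/
def cutoff (a b : ℝ) (f : ℝ → ℂ) : ℝ → ℂ :=
  mulOp1 (Set.indicator (Set.Ico a b) (fun _ => (1 : ℂ))) f
open scoped FourierTransform ContDiff

lemma fourier1_eq (f : ℝ → ℂ) : fourier1 f = 𝓕 f := by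
  ext x
  rw [Real.fourier_eq']
  unfold fourier1
  congr 1
  ext t
  simp only [RCLike.inner_apply, conj_trivial, smul_eq_mul]
  congr 3
  ring_nf

lemma fourierInv1_eq (f : ℝ → ℂ) : fourierInv1 f = 𝓕⁻ f := by
  ext x
  rw [Real.fourierInv_eq']
  unfold fourierInv1
  congr 1

lemma fourierInv1_neg (f : ℝ → ℂ) (x : ℝ) : fourierInv1 f x = 𝓕 f (-x) := by
  rw [fourierInv1_eq, Real.fourierInv_eq_fourier_neg]

lemma ind_hasDerivAt (G G' : ℝ → ℂ) (a b : ℝ) (hG : ∀ x, HasDerivAt G (G' x) x)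
    (ha : G a = 0) (hb : G b = 0) (ha' : G' a = 0) (hb' : G' b = 0) (x : ℝ) :
    HasDerivAt (Set.indicator (Set.Ico a b) G) (Set.indicator (Set.Ico a b) G' x) x := by
  by_cases hx : G x = 0 ∧ G' x = 0
  · have h0 : Set.indicator (Set.Ico a b) G' x = 0 := by
      by_cases h : x ∈ Set.Ico a b <;> simp [h, hx.2]
    have h1 : Set.indicator (Set.Ico a b) G x = 0 := by
      by_cases h : x ∈ Set.Ico a b <;> simp [h, hx.1]
    have := hG x
    rw [h0]
    rw [hx.2] at this
    rw [hasDerivAt_iff_isLittleO] at this ⊢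
    simp only [h1, hx.1, smul_zero, sub_zero] at this ⊢
    refine Asymptotics.IsBigO.trans_isLittleO ?_ this
    exact Asymptotics.IsBigO.of_bound 1 (Filter.Eventually.of_forall fun y => by
      rw [one_mul]; exact norm_indicator_le_norm_self _ _)
  · have hxa : x ≠ a := by rintro rfl; exact hx ⟨ha, ha'⟩
    have hxb : x ≠ b := by rintro rfl; exact hx ⟨hb, hb'⟩
    by_cases h : x ∈ Set.Ico a b
    · rw [Set.indicator_of_mem h]
      refine (hG x).congr_of_eventuallyEq ?_
      have : Set.Ioo a b ∈ nhds x := Ioo_mem_nhds (lt_of_le_of_ne h.1 hxa.symm) h.2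
      filter_upwards [this] with y hy
      rw [Set.indicator_of_mem (Set.Ioo_subset_Ico_self hy)]
    · rw [Set.indicator_of_notMem h]
      refine (hasDerivAt_const x (0:ℂ)).congr_of_eventuallyEq ?_
      have : (Set.Icc a b)ᶜ ∈ nhds x := by
        refine isClosed_Icc.isOpen_compl.mem_nhds ?_
        intro h'
        exact h ⟨h'.1, lt_of_le_of_ne h'.2 hxb⟩
      filter_upwards [this] with y hy
      rw [Set.indicator_of_notMem (fun h' => hy (Set.Ico_subset_Icc_self h'))]

lemma ind_integrable (G : ℝ → ℂ) (a b : ℝ) (hG : Continuous G) :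
    Integrable (Set.indicator (Set.Ico a b) G) := by
  rw [integrable_indicator_iff measurableSet_Ico]
  exact (hG.integrableOn_Icc).mono_set Set.Ico_subset_Icc_self

lemma ind_step (ψ s : ℝ → ℂ) (hψ : ContDiff ℝ ∞ ψ) (hs : ContDiff ℝ ∞ s) (a b : ℝ)
    (ha : s a = 0) (hb : s b = 0) (n : ℕ) :
    ∃ ψ₁ : ℝ → ℂ, ContDiff ℝ ∞ ψ₁ ∧ ∀ x,
      HasDerivAt (Set.indicator (Set.Ico a b) (fun x => ψ x * s x ^ (n + 2)))
        (Set.indicator (Set.Ico a b) (fun x => ψ₁ x * s x ^ (n + 1)) x) x := by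
  refine ⟨fun x => deriv ψ x * s x + (n + 2) * ψ x * deriv s x, ?_, ?_⟩
  · have h1 : ContDiff ℝ ∞ (deriv ψ) := (contDiff_infty_iff_deriv.1 hψ).2
    have h2 : ContDiff ℝ ∞ (deriv s) := (contDiff_infty_iff_deriv.1 hs).2
    fun_prop
  · apply ind_hasDerivAt
    · intro x
      have h1 := ((hψ.differentiable (by simp)) x).hasDerivAt
      have h2 := ((hs.differentiable (by simp)) x).hasDerivAt
      refine (h1.fun_mul (h2.fun_pow (n + 2))).congr_deriv ?_
      rw [show n + 2 - 1 = n + 1 from rfl]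
      push_cast
      ring
    all_goals simp [ha, hb]

lemma ind_decay (ψ s : ℝ → ℂ) (hψ : ContDiff ℝ ∞ ψ) (hs : ContDiff ℝ ∞ s) (a b : ℝ)
    (ha : s a = 0) (hb : s b = 0) :
    Continuous (Set.indicator (Set.Ico a b) (fun x => ψ x * s x ^ 3)) ∧
    ∃ C : ℝ, ∀ x, ‖𝓕 (Set.indicator (Set.Ico a b) (fun x => ψ x * s x ^ 3)) x‖
      ≤ C * (1 + x ^ 2)⁻¹ := by
  obtain ⟨ψ₁, h₁, hd₁⟩ := ind_step ψ s hψ hs a b ha hb 1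
  obtain ⟨ψ₂, h₂, hd₂⟩ := ind_step ψ₁ s h₁ hs a b ha hb 0
  simp only [Nat.reduceAdd, zero_add] at hd₁ hd₂
  set h := Set.indicator (Set.Ico a b) (fun x => ψ x * s x ^ 3)
  set h' := Set.indicator (Set.Ico a b) (fun x => ψ₁ x * s x ^ 2)
  set h'' := Set.indicator (Set.Ico a b) (fun x => ψ₂ x * s x ^ 1)
  have e1 : deriv h = h' := funext fun x => (hd₁ x).deriv
  have e2 : deriv h' = h'' := funext fun x => (hd₂ x).deriv
  have hdiff : Differentiable ℝ h := fun x => (hd₁ x).differentiableAt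
  have hdiff' : Differentiable ℝ h' := fun x => (hd₂ x).differentiableAt
  have c0 := hψ.continuous
  have c1 := h₁.continuous
  have c2 := h₂.continuous
  have cs := hs.continuous
  have i0 : Integrable h := ind_integrable _ _ _ (by fun_prop)
  have i1 : Integrable h' := ind_integrable _ _ _ (by fun_prop)
  have i2 : Integrable h'' := ind_integrable _ _ _ (by fun_prop)
  refine ⟨hdiff.continuous, (∫ x, ‖h x‖) + ∫ x, ‖h'' x‖, fun x => ?_⟩
  have f1 := Real.fourier_deriv i0 hdiff (e1 ▸ i1)
  have f2 := Real.fourier_deriv i1 hdiff' (e2 ▸ i2)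
  rw [e1] at f1
  rw [e2, f1] at f2
  have b0 : ‖𝓕 h x‖ ≤ ∫ x, ‖h x‖ :=
    VectorFourier.norm_fourierIntegral_le_integral_norm _ _ _ _ _
  have b2 : ‖𝓕 h'' x‖ ≤ ∫ x, ‖h'' x‖ :=
    VectorFourier.norm_fourierIntegral_le_integral_norm _ _ _ _ _
  rw [f2] at b2
  simp only [norm_smul, norm_mul, Complex.norm_real, Complex.norm_I, Complex.norm_ofNat,
    mul_one, Real.norm_eq_abs, abs_of_pos Real.pi_pos] at b2
  rw [← div_eq_mul_inv, le_div_iff₀ (by positivity)]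
  have hpi : 1 ≤ 2 * π := by linarith [Real.pi_gt_three]
  have : |x| * (|x| * ‖𝓕 h x‖) ≤ 2 * π * |x| * (2 * π * |x| * ‖𝓕 h x‖) := by
    have : |x| ≤ 2 * π * |x| := le_mul_of_one_le_left (abs_nonneg _) hpi
    gcongr
  have h3 : |x| * (|x| * ‖𝓕 h x‖) = x ^ 2 * ‖𝓕 h x‖ := by
    rw [← sq_abs]; ring
  nlinarith

lemma memLp_of_decay (g : ℝ → ℂ) (hg : Continuous g) (C : ℝ)
    (h : ∀ x, ‖g x‖ ≤ C * (1 + x ^ 2)⁻¹) (p : ℝ≥0∞) (hp : 1 ≤ p) (hp' : p ≠ ⊤) :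
    MemLp g p := by
  have hC : 0 ≤ C := by
    have := (norm_nonneg _).trans (h 0); simpa using this
  have hp0 : p ≠ 0 := (zero_lt_one.trans_le hp).ne'
  have hp1 : 1 ≤ p.toReal := by
    rw [← ENNReal.toReal_one]; exact ENNReal.toReal_mono hp' hp
  rw [← integrable_norm_rpow_iff hg.aestronglyMeasurable hp0 hp']
  refine (integrable_inv_one_add_sq.const_mul (C ^ p.toReal)).mono' ?_ ?_
  · exact (hg.norm.rpow_const (fun _ => Or.inr (by linarith))).aestronglyMeasurable
  · refine Filter.Eventually.of_forall fun x => ?_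
    rw [Real.norm_of_nonneg (by positivity)]
    calc ‖g x‖ ^ p.toReal ≤ (C * (1 + x ^ 2)⁻¹) ^ p.toReal := by gcongr; exact h x
      _ = C ^ p.toReal * ((1 + x ^ 2)⁻¹) ^ p.toReal := Real.mul_rpow hC (by positivity)
      _ ≤ C ^ p.toReal * (1 + x ^ 2)⁻¹ := by
        gcongr
        exact Real.rpow_le_self_of_le_one (by positivity)
          (inv_le_one_of_one_le₀ (by nlinarith [sq_nonneg x])) hp1

/-- the exponential `e(t)` -/
def ee (t : ℝ) : ℂ := Complex.exp (Complex.ofReal (2 * Real.pi * t) * Complex.I)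

lemma ee_add (s t : ℝ) : ee (s + t) = ee s * ee t := by
  unfold ee; rw [← Complex.exp_add]; congr 1; push_cast; ring

lemma ee_int (n : ℤ) : ee n = 1 := by
  unfold ee; rw [Complex.exp_eq_one_iff]; exact ⟨n, by push_cast; ring⟩

lemma ee_norm (t : ℝ) : ‖ee t‖ = 1 := Complex.norm_exp_ofReal_mul_I _

lemma ee_contDiff : ContDiff ℝ ∞ ee := by
  unfold ee
  have : ContDiff ℝ ∞ (fun t : ℝ => (Complex.ofReal (2 * Real.pi * t))) :=
    Complex.ofRealCLM.contDiff.comp (contDiff_const.mul contDiff_id)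
  exact (this.mul contDiff_const).cexp

lemma fourierInv1_ee (f : ℝ → ℂ) (x : ℝ) : fourierInv1 f x = ∫ ξ, ee (x * ξ) * f ξ := rfl

/-- the profile -/
def ww (y : ℝ) : ℂ := ∫ η in (0 : ℝ)..1, ee (y * η) * (ee η - 1) ^ 3

lemma ee_integral (m : ℤ) (hm : m ≠ 0) : ∫ η in (0 : ℝ)..1, ee (m * η) = 0 := by
  have hc : (2 * π * I * m : ℂ) ≠ 0 := by
    simp [hm, Real.pi_ne_zero]
  have := integral_exp_mul_complex (a := 0) (b := 1) hc
  have h2 : (fun η : ℝ => ee (m * η)) = fun η : ℝ => Complex.exp (2 * π * I * m * η) := by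
    ext η; unfold ee; congr 1; push_cast; ring
  rw [h2, this]
  have := ee_int m
  unfold ee at this
  have h3 : Complex.exp (2 * π * I * m * (1 : ℝ)) = 1 := by
    rw [← this]; congr 1; push_cast; ring
  rw [h3]; simp

lemma ww_zero : ww 0 = -1 := by
  have h : (fun η : ℝ => ee (0 * η) * (ee η - 1) ^ 3)
      = fun η : ℝ => ee ((3 : ℤ) * η) - 3 * ee ((2 : ℤ) * η) + 3 * ee ((1 : ℤ) * η) - 1 := by
    ext η
    have h2 : ee ((2 : ℤ) * η) = ee η ^ 2 := by
      rw [sq, ← ee_add]; congr 1; push_cast; ring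
    have h3 : ee ((3 : ℤ) * η) = ee η ^ 3 := by
      rw [pow_succ, sq, ← ee_add, ← ee_add]; congr 1; push_cast; ring
    have h0 : ee (0 * η) = 1 := by simpa using ee_int 0
    rw [h2, h3, h0]; simp; ring
  have hc := ee_contDiff.continuous
  have hi : ∀ m : ℤ, IntervalIntegrable (fun η : ℝ => ee (m * η)) volume 0 1 := fun m =>
    Continuous.intervalIntegrable (by fun_prop) _ _
  unfold ww
  rw [h, intervalIntegral.integral_sub (((hi 3).sub ((hi 2).const_mul 3)).add
      ((hi 1).const_mul 3)) (by simp),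
    intervalIntegral.integral_add ((hi 3).sub ((hi 2).const_mul 3)) ((hi 1).const_mul 3),
    intervalIntegral.integral_sub (hi 3) ((hi 2).const_mul 3),
    intervalIntegral.integral_const_mul, intervalIntegral.integral_const_mul,
    ee_integral 3 (by simp), ee_integral 2 (by simp), ee_integral 1 (by simp)]
  simp

lemma ww_lower : ∃ δ : ℝ, 0 < δ ∧ ∀ y, |y| ≤ δ → 1 / 2 ≤ ‖ww y‖ := by
  have hc := ee_contDiff.continuous
  have hcont : Continuous ww := by
    unfold ww
    apply intervalIntegral.continuous_parametric_intervalIntegral_of_continuous'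
    unfold Function.uncurry
    fun_prop
  have h1 : ∀ᶠ y in nhds (0 : ℝ), 1 / 2 < ‖ww y‖ := by
    apply (hcont.norm.continuousAt).eventually_const_lt
    simp only [ww_zero]; norm_num
  obtain ⟨ε, hε, h⟩ := Metric.eventually_nhds_iff.1 h1
  refine ⟨ε / 2, by positivity, fun y hy => (h ?_).le⟩
  rw [Real.dist_eq, sub_zero]; linarith

lemma piece_norm (M : ℕ) (hM : 0 < M) (c j : ℤ) (x : ℝ) :
    ‖fourierInv1 (Set.indicator (Set.Ico (c + j / M : ℝ) (c + (j + 1) / M))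
      (fun ξ => (ee (M * ξ) - 1) ^ 3)) x‖ = (M : ℝ)⁻¹ * ‖ww (x / M)‖ := by
  have hM' : (M : ℝ) ≠ 0 := by positivity
  set a : ℝ := c + j / M with ha
  have hb : (c + (j + 1) / M : ℝ) = 1 / M + a := by rw [ha]; field_simp; ring
  rw [hb]
  have hab : a ≤ 1 / M + a := by
    have : (0:ℝ) ≤ 1 / M := by positivity
    linarith
  rw [fourierInv1_ee]
  have e1 : (fun ξ => ee (x * ξ) * Set.indicator (Set.Ico a (1 / M + a))
      (fun ξ => (ee (M * ξ) - 1) ^ 3) ξ) = Set.indicator (Set.Ico a (1 / M + a))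
      (fun ξ => ee (x * ξ) * (ee (M * ξ) - 1) ^ 3) := by
    ext ξ; by_cases h : ξ ∈ Set.Ico a (1 / M + a) <;> simp only [Set.indicator, h, if_true, if_false, mul_zero]
  rw [e1, integral_indicator measurableSet_Ico, integral_Ico_eq_integral_Ioc,
    ← intervalIntegral.integral_of_le hab]
  have e2 := intervalIntegral.integral_comp_div_add (a := 0) (b := 1)
    (fun ξ => ee (x * ξ) * (ee (M * ξ) - 1) ^ 3) hM' a
  rw [zero_div, zero_add] at e2
  have hMa : ee (M * a) = 1 := by
    have : (M * a : ℝ) = ((M * c + j : ℤ) : ℝ) := by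
      rw [ha]; push_cast; field_simp
    rw [this, ee_int]
  have e3 : (fun η : ℝ => ee (x * (η / M + a)) * (ee (M * (η / M + a)) - 1) ^ 3)
      = fun η : ℝ => ee (x * a) * (ee (x / M * η) * (ee η - 1) ^ 3) := by
    ext η
    have h1 : x * (η / M + a) = x * a + x / M * η := by field_simp; ring
    have h2 : M * (η / M + a) = η + M * a := by field_simp
    rw [h1, h2, ee_add, ee_add, hMa]; ring
  rw [e3, intervalIntegral.integral_const_mul] at e2
  have e4 := congrArg norm e2
  rw [norm_mul, ee_norm, one_mul, norm_smul, Real.norm_of_nonneg (by positivity)] at e4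
  change ‖ww (x / M)‖ = _ at e4
  rw [e4, inv_mul_cancel_left₀ hM']

lemma mulOp_cutoff (f : ℝ → ℂ) (s : ℝ → ℂ) (hs : ContDiff ℝ ∞ s) (a b : ℝ)
    (ha : s a = 0) (hb : s b = 0) (hf : ∀ ξ ∈ Set.Ico a b, fourier1 f ξ = s ξ ^ 3) (ψ : ℝ → ℂ) :
    mulOp1 ψ (cutoff a b f) = fourierInv1 (Set.indicator (Set.Ico a b)
      (fun ξ => ψ ξ * s ξ ^ 3)) := by
  have h1 : cutoff a b f = fourierInv1 (Set.indicator (Set.Ico a b) (fun ξ => 1 * s ξ ^ 3)) := by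
    unfold cutoff mulOp1
    congr 1; ext ξ
    by_cases h : ξ ∈ Set.Ico a b
    · simp [h, hf ξ h]
    · simp [h]
  obtain ⟨hc, C, hC⟩ := ind_decay (fun _ => 1) s contDiff_const hs a b ha hb
  have hcs := hs.continuous
  have hi : Integrable (Set.indicator (Set.Ico a b) (fun ξ => 1 * s ξ ^ 3)) :=
    ind_integrable _ _ _ (by fun_prop)
  have hFc : Continuous (𝓕 (Set.indicator (Set.Ico a b) (fun ξ => 1 * s ξ ^ 3))) :=
    VectorFourier.fourierIntegral_continuous Real.continuous_fourierChar
      (by fun_prop) hi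
  have hFi := memLp_one_iff_integrable.1 (memLp_of_decay _ hFc C hC 1 le_rfl (by simp))
  have h2 := hc.fourier_fourierInv_eq hi hFi
  unfold mulOp1
  rw [h1, fourier1_eq, fourierInv1_eq (Set.indicator _ (fun ξ => 1 * s ξ ^ 3)), h2]
  congr 1; ext ξ
  by_cases h : ξ ∈ Set.Ico a b <;> simp [h]

lemma piece_memLp (ψ s : ℝ → ℂ) (hψ : ContDiff ℝ ∞ ψ) (hs : ContDiff ℝ ∞ s) (a b : ℝ)
    (ha : s a = 0) (hb : s b = 0) (p : ℝ≥0∞) (hp : 1 ≤ p) (hp' : p ≠ ⊤) :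
    MemLp (fourierInv1 (Set.indicator (Set.Ico a b) (fun ξ => ψ ξ * s ξ ^ 3))) p := by
  obtain ⟨hc, C, hC⟩ := ind_decay ψ s hψ hs a b ha hb
  have hcs := hs.continuous
  have hcψ := hψ.continuous
  have hi : Integrable (Set.indicator (Set.Ico a b) (fun ξ => ψ ξ * s ξ ^ 3)) :=
    ind_integrable _ _ _ (by fun_prop)
  have hFc : Continuous (𝓕 (Set.indicator (Set.Ico a b) (fun ξ => ψ ξ * s ξ ^ 3))) :=
    VectorFourier.fourierIntegral_continuous Real.continuous_fourierChar
      (by fun_prop) hi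
  refine memLp_of_decay _ ?_ C (fun x => ?_) p hp hp'
  · have := hFc.comp continuous_neg
    convert this using 1
    ext x; exact fourierInv1_neg _ x
  · rw [fourierInv1_neg]; simpa using hC (-x)

lemma exists_lam : ∃ Λ : ℝ → ℂ, ContDiff ℝ ∞ Λ ∧ (∀ ξ, |ξ| ≤ 1 → Λ ξ = 1) ∧
    (∀ ξ, 2 ≤ |ξ| → Λ ξ = 0) := by
  let b : ContDiffBump (0 : ℝ) := ⟨1, 2, by norm_num, by norm_num⟩
  refine ⟨fun ξ => ((b ξ : ℝ) : ℂ), ?_, ?_, ?_⟩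
  · exact Complex.ofRealCLM.contDiff.comp b.contDiff
  · intro ξ h
    beta_reduce
    rw [b.one_of_mem_closedBall (by simpa [b] using h)]; simp
  · intro ξ h
    beta_reduce
    rw [b.zero_of_le_dist (by simpa [b] using h)]; simp

lemma compact_of_zero (W : ℝ → ℂ) (R : ℝ) (h : ∀ ξ, R ≤ |ξ| → W ξ = 0) :
    HasCompactSupport W := by
  refine HasCompactSupport.intro (isCompact_Icc (a := -R) (b := R)) fun x hx => h x ?_
  by_contra h'
  rw [not_le, abs_lt] at h'
  exact hx ⟨h'.1.le, h'.2.le⟩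

lemma exists_test (Λ : ℝ → ℂ) (hΛ : ContDiff ℝ ∞ Λ) (hΛ0 : ∀ ξ, 2 ≤ |ξ| → Λ ξ = 0)
    (c : ℤ) (M : ℕ) : ∃ f : SchwartzMap ℝ ℂ,
      fourier1 f = fun ξ => Λ (ξ - c) * (ee (M * ξ) - 1) ^ 3 := by
  have h1 : ContDiff ℝ ∞ (fun ξ : ℝ => Λ (ξ - c) * (ee (M * ξ) - 1) ^ 3) := by
    have := ee_contDiff
    fun_prop
  have h2 : HasCompactSupport (fun ξ : ℝ => Λ (ξ - c) * (ee (M * ξ) - 1) ^ 3) := by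
    refine compact_of_zero _ (2 + |(c : ℝ)|) fun ξ h => ?_
    have := abs_sub_abs_le_abs_sub ξ c
    rw [hΛ0 _ (by linarith), zero_mul]
  refine ⟨𝓕⁻ (h2.toSchwartzMap h1), ?_⟩
  rw [fourier1_eq, ← SchwartzMap.fourier_coe]
  rw [FourierTransform.fourier_fourierInv_eq]
  rfl

lemma ee_shift_integrable (W : ℝ → ℂ) (hW : Integrable W) (x : ℝ) :
    Integrable (fun ξ => ee (x * ξ) * W ξ) := by
  have := ee_contDiff.continuous
  refine hW.bdd_mul (c := 1) (by fun_prop) (Filter.Eventually.of_forall fun ξ => ?_)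
  rw [ee_norm]

lemma fourierInv_shift (W : ℝ → ℂ) (hW : Integrable W) (c : ℤ) (M : ℕ) (x : ℝ) :
    fourierInv1 (fun ξ => W (ξ - c) * (ee (M * ξ) - 1) ^ 3) x =
      ee (x * c) * (fourierInv1 W (x + 3 * M) - 3 * fourierInv1 W (x + 2 * M)
        + 3 * fourierInv1 W (x + M) - fourierInv1 W x) := by
  simp only [fourierInv1_ee]
  rw [← integral_add_right_eq_self _ (c : ℝ)]
  have hi := ee_shift_integrable W hW
  have i2 : Integrable (fun ξ => 3 * (ee ((x + 2 * M) * ξ) * W ξ)) := (hi _).const_mul 3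
  have i1 : Integrable (fun ξ => 3 * (ee ((x + M) * ξ) * W ξ)) := (hi _).const_mul 3
  have i3 : Integrable (fun ξ => ee ((x + 3 * M) * ξ) * W ξ - 3 * (ee ((x + 2 * M) * ξ) * W ξ)) :=
    (hi _).sub i2
  have i4 : Integrable (fun ξ => ee ((x + 3 * M) * ξ) * W ξ - 3 * (ee ((x + 2 * M) * ξ) * W ξ)
      + 3 * (ee ((x + M) * ξ) * W ξ)) := i3.add i1
  rw [← integral_const_mul, ← integral_const_mul, ← integral_sub (hi _) i2,
    ← integral_add i3 i1, ← integral_sub i4 (hi _), ← integral_const_mul]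
  congr 1
  ext ξ
  have hMc : ee (M * c) = 1 := by
    have := ee_int (M * c); push_cast at this; exact this
  have e0 : ee (M * (ξ + c)) = ee (M * ξ) := by rw [mul_add, ee_add, hMc, mul_one]
  have e1 : ee ((x + M) * ξ) = ee (x * ξ) * ee (M * ξ) := by rw [← ee_add]; congr 1; ring
  have e2 : ee ((x + 2 * M) * ξ) = ee (x * ξ) * ee (M * ξ) ^ 2 := by
    rw [sq, ← ee_add, ← ee_add]; congr 1; ring
  have e3 : ee ((x + 3 * M) * ξ) = ee (x * ξ) * ee (M * ξ) ^ 3 := by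
    rw [pow_succ, sq, ← ee_add, ← ee_add, ← ee_add]; congr 1; ring
  have e4 : ee (x * (ξ + c)) = ee (x * c) * ee (x * ξ) := by rw [← ee_add]; congr 1; ring
  simp only [e0, e1, e2, e3, e4, add_sub_cancel_right]
  ring

lemma eLpNorm_shift (V : ℝ → ℂ) (hV : Continuous V) (t : ℝ) (p : ℝ≥0∞) :
    eLpNorm (fun x => V (x + t)) p = eLpNorm V p :=
  eLpNorm_comp_measurePreserving (f := fun x : ℝ => x + t) hV.aestronglyMeasurable
    (measurePreserving_add_right volume t)

lemma eLpNorm_tri (A B C E : ℝ → ℂ) (p : ℝ≥0∞) (hp : 1 ≤ p) (hA : Continuous A)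
    (hB : Continuous B) (hC : Continuous C) (hE : Continuous E) :
    eLpNorm (A - B + C - E) p volume ≤
      eLpNorm A p volume + eLpNorm B p volume + eLpNorm C p volume + eLpNorm E p volume := by
  refine (eLpNorm_sub_le ((hA.sub hB).add hC).aestronglyMeasurable
    hE.aestronglyMeasurable hp).trans (add_le_add ?_ le_rfl)
  refine (eLpNorm_add_le (hA.sub hB).aestronglyMeasurable
    hC.aestronglyMeasurable hp).trans (add_le_add ?_ le_rfl)
  exact eLpNorm_sub_le hA.aestronglyMeasurable hB.aestronglyMeasurable hp

lemma eLpNorm_three (A : ℝ → ℂ) (p : ℝ≥0∞) :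
    eLpNorm (fun x => 3 * A x) p volume = 3 * eLpNorm A p volume := by
  have h : (fun x => 3 * A x) = (3 : ℂ) • A := by ext x; simp
  have h3 : ‖(3 : ℂ)‖ₑ = 3 := by rw [← ofReal_norm]; simp
  rw [h, eLpNorm_const_smul, h3]

lemma eLpNorm_four (V : ℝ → ℂ) (hV : Continuous V) (M c : ℝ) (p : ℝ≥0∞) (hp : 1 ≤ p) :
    eLpNorm (fun x => ee (x * c) * (V (x + 3 * M) - 3 * V (x + 2 * M)
        + 3 * V (x + M) - V x)) p volume ≤ 8 * eLpNorm V p volume := by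
  let A : ℝ → ℂ := fun x => V (x + 3 * M)
  let B : ℝ → ℂ := fun x => 3 * V (x + 2 * M)
  let C : ℝ → ℂ := fun x => 3 * V (x + M)
  have hA : eLpNorm A p volume = eLpNorm V p volume := eLpNorm_shift V hV _ p
  have hB : eLpNorm B p volume = 3 * eLpNorm V p volume := by
    rw [← eLpNorm_shift V hV (2 * M) p]; exact eLpNorm_three _ p
  have hC : eLpNorm C p volume = 3 * eLpNorm V p volume := by
    rw [← eLpNorm_shift V hV M p]; exact eLpNorm_three _ p
  have h1 : eLpNorm (fun x => ee (x * c) * (V (x + 3 * M) - 3 * V (x + 2 * M)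
        + 3 * V (x + M) - V x)) p volume = eLpNorm (A - B + C - V) p volume := by
    refine eLpNorm_congr_norm_ae (Filter.Eventually.of_forall fun x => ?_)
    rw [norm_mul, ee_norm, one_mul]; rfl
  rw [h1]
  refine (eLpNorm_tri A B C V p hp (by fun_prop) (by fun_prop) (by fun_prop) hV).trans ?_
  rw [hA, hB, hC]
  apply le_of_eq
  ring

lemma schw (W : ℝ → ℂ) (hWc : HasCompactSupport W) (hWs : ContDiff ℝ ∞ W) (p : ℝ≥0∞) :
    Continuous (fourierInv1 W) ∧ eLpNorm (fourierInv1 W) p volume ≠ ⊤ := by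
  let w : SchwartzMap ℝ ℂ := hWc.toSchwartzMap hWs
  let v : SchwartzMap ℝ ℂ := 𝓕⁻ w
  have hV : fourierInv1 W = ⇑v := by
    rw [fourierInv1_eq]
    exact (SchwartzMap.fourierInv_coe w).symm
  rw [hV]
  have h2 : MemLp (⇑v) p volume := SchwartzMap.memLp v p volume
  exact ⟨v.continuous, h2.eLpNorm_ne_top⟩

lemma rhs_bound (φ : SchwartzMap ℝ ℝ) (hsupp : ∀ x : ℝ, x ∉ Set.Icc (-1 : ℝ) 1 → φ x = 0)
    (p q : ℝ≥0∞) (hp : 1 ≤ p)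
    (Λ : ℝ → ℂ) (hΛ : ContDiff ℝ ∞ Λ) (hΛ0 : ∀ ξ, 2 ≤ |ξ| → Λ ξ = 0) :
    ∃ R : ℝ≥0, ∀ (c : ℤ) (M : ℕ) (f : ℝ → ℂ),
      (fourier1 f = fun ξ => Λ (ξ - c) * (ee (M * ξ) - 1) ^ 3) →
      lqlpNorm p q (fun k => mulOp1 (fun ξ => (φ (ξ - k) : ℂ)) f) ≤ R := by
  have hφ : ContDiff ℝ ∞ (fun ξ => (φ ξ : ℂ)) := Complex.ofRealCLM.contDiff.comp (φ.smooth _)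
  let W : ℤ → ℝ → ℂ := fun l ξ => (φ (ξ - l) : ℂ) * Λ ξ
  have hWc : ∀ l, HasCompactSupport (W l) := fun l =>
    compact_of_zero _ 2 fun ξ h => by simp [W, hΛ0 ξ h]
  have hWs : ∀ l, ContDiff ℝ ∞ (W l) := fun l => by
    have : ContDiff ℝ ∞ (fun ξ : ℝ => (φ (ξ - l) : ℂ)) := hφ.comp (contDiff_id.sub contDiff_const)
    exact this.mul hΛ
  have hWi : ∀ l, Integrable (W l) := fun l =>
    (hWs l).continuous.integrable_of_hasCompactSupport (hWc l)
  have hVc : ∀ l, Continuous (fourierInv1 (W l)) := fun l => (schw _ (hWc l) (hWs l) p).1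
  have hVt : ∀ l, eLpNorm (fourierInv1 (W l)) p volume ≠ ⊤ := fun l =>
    (schw _ (hWc l) (hWs l) p).2
  have hW0 : ∀ l : ℤ, l ∉ Finset.Icc (-2 : ℤ) 2 → W l = 0 := by
    intro l hl
    ext ξ
    by_cases h : 2 ≤ |ξ|
    · simp [W, hΛ0 ξ h]
    · have : φ (ξ - l) = 0 := by
        apply hsupp
        rintro ⟨h1, h2⟩
        rw [not_le, abs_lt] at h
        apply hl
        rw [Finset.mem_Icc]
        have h3 : (l : ℝ) < (3 : ℤ) := by push_cast; linarith
        have h4 : ((-3 : ℤ) : ℝ) < l := by push_cast; linarith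
        rw [Int.cast_lt] at h3 h4
        omega
      simp [W, this]
  let B : ℝ := ∑ l ∈ Finset.Icc (-2 : ℤ) 2, (8 * eLpNorm (fourierInv1 (W l)) p volume).toReal
  have hB0 : 0 ≤ B := Finset.sum_nonneg fun _ _ => ENNReal.toReal_nonneg
  refine ⟨B.toNNReal * 5 ^ (1 / q.toReal), fun c M f hf => ?_⟩
  have key : ∀ k : ℤ, eLpNorm (mulOp1 (fun ξ => (φ (ξ - k) : ℂ)) f) p volume
      ≤ 8 * eLpNorm (fourierInv1 (W (k - c))) p volume := by
    intro k
    have : mulOp1 (fun ξ => (φ (ξ - k) : ℂ)) f = fun x =>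
        ee (x * c) * (fourierInv1 (W (k - c)) (x + 3 * M)
          - 3 * fourierInv1 (W (k - c)) (x + 2 * M)
          + 3 * fourierInv1 (W (k - c)) (x + M) - fourierInv1 (W (k - c)) x) := by
      ext x
      rw [← fourierInv_shift _ (hWi _)]
      unfold mulOp1
      rw [hf]
      congr 1
      ext ξ
      simp only [W]
      have : ξ - c - ((k - c : ℤ) : ℝ) = ξ - k := by push_cast; ring
      rw [this]; ring
    rw [this]
    exact eLpNorm_four _ (hVc _) _ _ _ hp
  unfold lqlpNorm
  have hle : eLpNorm (fun k : ℤ => (eLpNorm (mulOp1 (fun ξ => (φ (ξ - k) : ℂ)) f) p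
      volume).toReal) q Measure.count ≤
      eLpNorm (Set.indicator (↑(Finset.Icc (c - 2) (c + 2)) : Set ℤ) (fun _ => B)) q
        Measure.count := by
    refine eLpNorm_mono fun k => ?_
    rw [Real.norm_of_nonneg ENNReal.toReal_nonneg]
    by_cases hk : k ∈ Finset.Icc (c - 2) (c + 2)
    · rw [Set.indicator_of_mem (by exact_mod_cast hk), Real.norm_of_nonneg hB0]
      refine (ENNReal.toReal_mono (ENNReal.mul_ne_top (by simp) (hVt _)) (key k)).trans ?_
      refine Finset.single_le_sum
        (f := fun l => (8 * eLpNorm (fourierInv1 (W l)) p volume).toReal)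
        (fun _ _ => ENNReal.toReal_nonneg) ?_
      rw [Finset.mem_Icc] at hk ⊢; omega
    · have h0 : W (k - c) = 0 := hW0 _ (by rw [Finset.mem_Icc] at hk ⊢; omega)
      have h1 : fourierInv1 (0 : ℝ → ℂ) = 0 := by ext x; simp [fourierInv1]
      have := key k
      rw [h0, h1, eLpNorm_zero, mul_zero, nonpos_iff_eq_zero] at this
      rw [this]; simp
  refine hle.trans ((eLpNorm_indicator_const_le _ _).trans ?_)
  rw [Measure.count_apply_finset]
  have hcard : (Finset.Icc (c - 2) (c + 2)).card = 5 := by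
    rw [Int.card_Icc]; omega
  rw [hcard]
  push_cast
  rw [ENNReal.coe_rpow_of_nonneg _ (by positivity)]
  gcongr
  · rw [← ofReal_norm, Real.norm_of_nonneg hB0]; rfl
  · simp

lemma fourierInv1_add (f g : ℝ → ℂ) (hf : Integrable f) (hg : Integrable g) (x : ℝ) :
    fourierInv1 (fun ξ => f ξ + g ξ) x = fourierInv1 f x + fourierInv1 g x := by
  simp only [fourierInv1_ee]
  rw [← integral_add (ee_shift_integrable f hf x) (ee_shift_integrable g hg x)]
  congr 1; ext ξ; ring

lemma phi_two (φ : SchwartzMap ℝ ℝ)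
    (hsupp : ∀ x : ℝ, x ∉ Set.Icc (-1 : ℝ) 1 → φ x = 0)
    (hsum : ∀ ξ : ℝ, ∑' k : ℤ, φ (ξ - k) = 1) (c : ℤ) (ξ : ℝ) (h1 : (c : ℝ) < ξ)
    (h2 : ξ < c + 1) : φ (ξ - c) + φ (ξ - (c + 1 : ℤ)) = 1 := by
  rw [← hsum ξ, tsum_eq_sum (s := {c, c + 1}), Finset.sum_pair (by omega)]
  intro k hk
  apply hsupp
  rintro ⟨h3, h4⟩
  have h5 : (k : ℝ) < (c + 2 : ℤ) := by push_cast; linarith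
  have h6 : ((c - 1 : ℤ) : ℝ) < k := by push_cast; linarith
  rw [Int.cast_lt] at h5 h6
  simp only [Finset.mem_insert, Finset.mem_singleton] at hk
  omega

lemma sqrt_memLp (M : ℕ) (g : ℕ → ℝ → ℂ) (p : ℝ≥0∞) (hg : ∀ j, j < M → MemLp (g j) p) :
    MemLp (fun x => Real.sqrt (∑ j ∈ Finset.range M, ‖g j x‖ ^ 2)) p := by
  have h1 : MemLp (fun x => ∑ j ∈ Finset.range M, ‖g j x‖) p :=
    memLp_finsetSum _ fun j hj => (hg j (Finset.mem_range.1 hj)).norm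
  refine h1.mono ?_ (Filter.Eventually.of_forall fun x => ?_)
  · refine Real.continuous_sqrt.comp_aestronglyMeasurable ?_
    refine Finset.aestronglyMeasurable_fun_sum _ fun j hj => ?_
    exact (hg j (Finset.mem_range.1 hj)).1.norm.pow 2
  · rw [Real.norm_of_nonneg (Real.sqrt_nonneg _), Real.norm_of_nonneg (by positivity)]
    rw [Real.sqrt_le_iff]
    exact ⟨by positivity, Finset.sum_sq_le_sq_sum_of_nonneg fun _ _ => norm_nonneg _⟩

lemma lhs_lower (φ : SchwartzMap ℝ ℝ)
    (hsupp : ∀ x : ℝ, x ∉ Set.Icc (-1 : ℝ) 1 → φ x = 0)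
    (hsum : ∀ ξ : ℝ, ∑' k : ℤ, φ (ξ - k) = 1)
    (p q : ℝ≥0∞) (hp : 1 ≤ p) (hp' : p ≠ ⊤) (hq : 1 ≤ q)
    (Λ : ℝ → ℂ) (hΛ1 : ∀ ξ, |ξ| ≤ 1 → Λ ξ = 1)
    (δ : ℝ) (hδ : 0 < δ) (hw : ∀ y, |y| ≤ δ → 1 / 2 ≤ ‖ww y‖)
    (c : ℤ) (M : ℕ) (hM : 0 < M) (f : ℝ → ℂ)
    (hf : fourier1 f = fun ξ => Λ (ξ - c) * (ee (M * ξ) - 1) ^ 3)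
    (a b : ℤ → ℝ) (idx : ℕ → ℤ) (hidx : Function.Injective idx)
    (ha : ∀ j < M, a (idx j) = c + j / M) (hb : ∀ j < M, b (idx j) = c + (j + 1) / M)
    (hout : ∀ m, (∀ j < M, m ≠ idx j) → ∀ ξ ∈ Set.Ico (a m) (b m), fourier1 f ξ = 0) :
    ENNReal.ofReal (1 / (3 * Real.sqrt M) * (2 * δ * M) ^ (1 / p.toReal)) ≤
      2 * lqlpl2Norm p q
        (fun k n => mulOp1 (fun ξ => (φ (ξ - k) : ℂ)) (cutoff (a n) (b n) f)) := by
  have hM' : (0 : ℝ) < M := by exact_mod_cast hM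
  have hp0 : p ≠ 0 := (zero_lt_one.trans_le hp).ne'
  have hq0 : q ≠ 0 := (zero_lt_one.trans_le hq).ne'
  have hφ : ContDiff ℝ ∞ (fun ξ => (φ ξ : ℂ)) := Complex.ofRealCLM.contDiff.comp (φ.smooth _)
  have hφk : ∀ k : ℤ, ContDiff ℝ ∞ (fun ξ : ℝ => (φ (ξ - k) : ℂ)) := fun k =>
    hφ.comp (contDiff_id.sub contDiff_const)
  have hs : ContDiff ℝ ∞ (fun ξ : ℝ => ee (M * ξ) - 1) := by
    have := ee_contDiff
    fun_prop
  have hsz : ∀ j : ℤ, ee (M * (c + j / M)) - 1 = 0 := fun j => by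
    have : (M * (c + j / M) : ℝ) = ((M * c + j : ℤ) : ℝ) := by push_cast; field_simp
    rw [this, ee_int, sub_self]
  have hsa : ∀ j : ℕ, ee (M * (c + j / M)) - 1 = 0 := fun j => by simpa using hsz j
  have hsb : ∀ j : ℕ, ee (M * (c + (j + 1) / M)) - 1 = 0 := fun j => by simpa using hsz (j + 1)
  let I : ℕ → Set ℝ := fun j => Set.Ico (c + j / M : ℝ) (c + (j + 1) / M)
  have hI : ∀ j < M, ∀ ξ ∈ I j, (c : ℝ) ≤ ξ ∧ ξ < c + 1 := by
    intro j hj ξ hξ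
    have h1 : (0 : ℝ) ≤ j / M := by positivity
    have h2 : ((j : ℝ) + 1) / M ≤ 1 := by
      rw [div_le_one hM']; exact_mod_cast hj
    exact ⟨by linarith [hξ.1], by linarith [hξ.2]⟩
  let g : ℤ → ℕ → ℝ → ℂ := fun k j => fourierInv1 (Set.indicator (I j)
      (fun ξ => (φ (ξ - k) : ℂ) * (ee (M * ξ) - 1) ^ 3))
  have hg : ∀ k j, MemLp (g k j) p := fun k j =>
    piece_memLp _ _ (hφk k) hs _ _ (hsa j) (hsb j) p hp hp'
  let S : ℤ → ℝ → ℝ := fun k x => Real.sqrt (∑ j ∈ Finset.range M, ‖g k j x‖ ^ 2)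
  have hS : ∀ k, MemLp (S k) p := fun k => sqrt_memLp M (g k) p fun j _ => hg k j
  have hF1 : ∀ k : ℤ, ∀ j < M, mulOp1 (fun ξ => (φ (ξ - k) : ℂ))
      (cutoff (a (idx j)) (b (idx j)) f) = g k j := by
    intro k j hj
    rw [ha j hj, hb j hj]
    refine mulOp_cutoff f _ hs _ _ (hsa j) (hsb j) ?_ _
    intro ξ hξ
    have := hI j hj ξ hξ
    rw [hf]
    simp only
    rw [hΛ1 _ (by rw [abs_le]; constructor <;> linarith), one_mul]
  have hF0 : ∀ k : ℤ, ∀ m, (∀ j < M, m ≠ idx j) → mulOp1 (fun ξ => (φ (ξ - k) : ℂ))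
      (cutoff (a m) (b m) f) = 0 := by
    intro k m hm
    have h0 : cutoff (a m) (b m) f = 0 := by
      ext x
      unfold cutoff mulOp1 fourierInv1
      rw [Pi.zero_apply]
      refine integral_eq_zero_of_ae (Filter.Eventually.of_forall fun ξ => ?_)
      by_cases h : ξ ∈ Set.Ico (a m) (b m)
      · simp [hout m hm ξ h]
      · simp [h]
    rw [h0]
    ext x
    simp [mulOp1, fourier1, fourierInv1]
  have hts : ∀ (k : ℤ) (x : ℝ), ∑' m : ℤ, ‖mulOp1 (fun ξ => (φ (ξ - k) : ℂ))
      (cutoff (a m) (b m) f) x‖ ^ 2 = ∑ j ∈ Finset.range M, ‖g k j x‖ ^ 2 := by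
    intro k x
    rw [tsum_eq_sum (s := (Finset.range M).image idx)]
    · rw [Finset.sum_image (fun _ _ _ _ h => hidx h)]
      refine Finset.sum_congr rfl fun j hj => ?_
      rw [hF1 k j (Finset.mem_range.1 hj)]
    · intro m hm
      rw [hF0 k m]
      · simp
      · rintro j hj rfl
        exact hm (Finset.mem_image_of_mem _ (Finset.mem_range.2 hj))
  have hL : ∀ k : ℤ, eLpNorm (S k) p volume ≤ lqlpl2Norm p q
        (fun k n => mulOp1 (fun ξ => (φ (ξ - k) : ℂ)) (cutoff (a n) (b n) f)) := by
    intro k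
    unfold lqlpl2Norm
    have := enorm_le_eLpNorm_count (fun k : ℤ => (eLpNorm (fun x : ℝ => Real.sqrt (∑' m : ℤ,
      ‖mulOp1 (fun ξ => (φ (ξ - k) : ℂ)) (cutoff (a m) (b m) f) x‖ ^ 2)) p volume).toReal) k hq0
    refine le_trans (le_of_eq ?_) this
    simp only [hts]
    rw [← ofReal_norm, Real.norm_of_nonneg ENNReal.toReal_nonneg,
      ENNReal.ofReal_toReal (hS k).eLpNorm_ne_top]
  have hpt : ∀ x ∈ Set.Icc (-(δ * M)) (δ * M),
      1 / (3 * Real.sqrt M) ≤ S c x + S (c + 1) x := by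
    intro x hx
    have hx' : |x / M| ≤ δ := by
      rw [abs_div, abs_of_pos hM', div_le_iff₀ hM']; exact abs_le.2 hx
    have hterm : ∀ j < M, 1 / (4 * (M : ℝ) ^ 2) ≤
        2 * (‖g c j x‖ ^ 2 + ‖g (c + 1) j x‖ ^ 2) := by
      intro j hj
      have e1 := piece_norm M hM c j x
      have e2 : Set.indicator (Set.Ico (c + (j : ℤ) / M : ℝ) (c + ((j : ℤ) + 1) / M))
          (fun ξ => (ee (M * ξ) - 1) ^ 3) = fun ξ => Set.indicator (I j)
          (fun ξ => (φ (ξ - c) : ℂ) * (ee (M * ξ) - 1) ^ 3) ξ + Set.indicator (I j)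
          (fun ξ => (φ (ξ - (c + 1 : ℤ)) : ℂ) * (ee (M * ξ) - 1) ^ 3) ξ := by
        ext ξ
        by_cases h : ξ ∈ I j
        · have h' : ξ ∈ Set.Ico (c + (j : ℤ) / M : ℝ) (c + ((j : ℤ) + 1) / M) := by
            simpa [I] using h
          rw [Set.indicator_of_mem h, Set.indicator_of_mem h, Set.indicator_of_mem h', ← add_mul]
          obtain ⟨h1, h2⟩ := hI j hj ξ h
          rcases h1.eq_or_lt with h1 | h1
          · have := hsa 0
            simp only [Nat.cast_zero, zero_div, add_zero] at this
            rw [← h1, this]; simp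
          · rw [← Complex.ofReal_add, phi_two φ hsupp hsum c ξ h1 h2]; simp
        · have h' : ξ ∉ Set.Ico (c + (j : ℤ) / M : ℝ) (c + ((j : ℤ) + 1) / M) := by
            simpa [I] using h
          rw [Set.indicator_of_notMem h, Set.indicator_of_notMem h, Set.indicator_of_notMem h',
            add_zero]
      have hint : ∀ k : ℤ, Integrable (Set.indicator (I j)
          (fun ξ => (φ (ξ - k) : ℂ) * (ee (M * ξ) - 1) ^ 3)) := fun k =>
        ind_integrable _ _ _ ((hφk k).continuous.mul (hs.continuous.pow 3))
      rw [e2, fourierInv1_add _ _ (hint c) (hint (c + 1))] at e1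
      change ‖g c j x + g (c + 1) j x‖ = _ at e1
      have h3 : (M : ℝ)⁻¹ * (1 / 2) ≤ ‖g c j x‖ + ‖g (c + 1) j x‖ := by
        calc (M : ℝ)⁻¹ * (1 / 2) ≤ (M : ℝ)⁻¹ * ‖ww (x / M)‖ := by gcongr; exact hw _ hx'
          _ = _ := e1.symm
          _ ≤ _ := norm_add_le _ _
      have h4 : ((M : ℝ)⁻¹ * (1 / 2)) ^ 2 ≤ (‖g c j x‖ + ‖g (c + 1) j x‖) ^ 2 := by gcongr
      have h5 : 1 / (4 * (M : ℝ) ^ 2) = ((M : ℝ)⁻¹ * (1 / 2)) ^ 2 := by field_simp; norm_num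
      rw [h5]
      nlinarith [sq_nonneg (‖g c j x‖ - ‖g (c + 1) j x‖)]
    have hsum2 := Finset.sum_le_sum fun j hj => hterm j (Finset.mem_range.1 hj)
    rw [Finset.sum_const, Finset.card_range, nsmul_eq_mul, ← Finset.mul_sum,
      Finset.sum_add_distrib] at hsum2
    have s0 : S c x ^ 2 = ∑ j ∈ Finset.range M, ‖g c j x‖ ^ 2 := Real.sq_sqrt (by positivity)
    have s1 : S (c + 1) x ^ 2 = ∑ j ∈ Finset.range M, ‖g (c + 1) j x‖ ^ 2 :=
      Real.sq_sqrt (by positivity)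
    rw [← s0, ← s1] at hsum2
    have p0 : 0 ≤ S c x := Real.sqrt_nonneg _
    have p1 : 0 ≤ S (c + 1) x := Real.sqrt_nonneg _
    refine (sq_le_sq₀ (by positivity) (by positivity)).1 ?_
    have h6 : (1 / (3 * Real.sqrt M)) ^ 2 = 1 / 9 * (1 / M) := by
      rw [div_pow, mul_pow, Real.sq_sqrt hM'.le]; field_simp; norm_num
    have h7 : (M : ℝ) * (1 / (4 * (M : ℝ) ^ 2)) = 1 / 4 * (1 / M) := by field_simp
    rw [h7] at hsum2
    rw [h6]
    have h8 : (0 : ℝ) ≤ 1 / M := by positivity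
    nlinarith [mul_nonneg p0 p1]
  have hlow : eLpNorm (Set.indicator (Set.Icc (-(δ * M)) (δ * M))
      (fun _ => 1 / (3 * Real.sqrt M))) p volume ≤ eLpNorm (S c + S (c + 1)) p volume := by
    refine eLpNorm_mono fun x => ?_
    by_cases hx : x ∈ Set.Icc (-(δ * M)) (δ * M)
    · rw [Set.indicator_of_mem hx, Real.norm_of_nonneg (by positivity)]
      exact (hpt x hx).trans (le_abs_self _)
    · rw [Set.indicator_of_notMem hx]; simp
  rw [eLpNorm_indicator_const measurableSet_Icc hp0 hp', Real.volume_Icc] at hlow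
  have hfin := hlow.trans (eLpNorm_add_le (hS c).1 (hS (c + 1)).1 hp)
  calc _ = _ := ?_
    _ ≤ _ := hfin
    _ ≤ _ := by rw [two_mul]; exact add_le_add (hL _) (hL _)
  rw [ENNReal.ofReal_mul (by positivity), ← ofReal_norm, Real.norm_of_nonneg (by positivity),
    ENNReal.ofReal_rpow_of_nonneg (by nlinarith) (by positivity)]
  congr 3
  ring

/-- `p ≥ 2` is necessary in the modulation-space Rubio de Francia theorem:
for each `1 < p < 2` and `1 ≤ q ≤ ∞` there is a collection of pairwise disjoint
intervals `ω_n = [a_n, b_n)` whose Littlewood–Paley operator `Δ_Ω` is not bounded from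
`M_{p,q}(ℝ)` to `M_{p,q}(ℓ²)` (discrete-norm formulation). -/
theorem rubio_de_francia_necessity (φ : SchwartzMap ℝ ℝ)
    (hsupp : ∀ x : ℝ, x ∉ Set.Icc (-1 : ℝ) 1 → φ x = 0)
    (hsum : ∀ ξ : ℝ, ∑' k : ℤ, φ (ξ - k) = 1)
    (p q : ℝ≥0∞) (hp1 : 1 < p) (hp2 : p < 2) (hq : 1 ≤ q) :
    ∃ a b : ℤ → ℝ,
      (∀ m n : ℤ, m ≠ n → Disjoint (Set.Ico (a m) (b m)) (Set.Ico (a n) (b n))) ∧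
      ¬ ∃ D : ℝ≥0, ∀ f : SchwartzMap ℝ ℂ,
          lqlpl2Norm p q
              (fun k n => mulOp1 (fun ξ => (φ (ξ - k) : ℂ)) (cutoff (a n) (b n) ⇑f))
            ≤ D * lqlpNorm p q (fun k => mulOp1 (fun ξ => (φ (ξ - k) : ℂ)) ⇑f) := by
  have hp1' : 1 ≤ p := hp1.le
  have hpt : p ≠ ⊤ := (hp2.trans (by simp)).ne
  obtain ⟨Λ, hΛ, hΛ1, hΛ0⟩ := exists_lam
  obtain ⟨δ, hδ, hw⟩ := ww_lower
  obtain ⟨R, hR⟩ := rhs_bound φ hsupp p q hp1' Λ hΛ hΛ0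
  let e : ℤ ≃ ℕ × ℕ := (Denumerable.eqv ℤ).trans (Denumerable.eqv (ℕ × ℕ)).symm
  let a : ℤ → ℝ := fun m =>
    ((10 * (e m).1 : ℤ) : ℝ) + ((e m).2 : ℝ) / (((e m).1 + 1 : ℕ) : ℝ)
  let b : ℤ → ℝ := fun m => if (e m).2 < (e m).1 + 1 then
    ((10 * (e m).1 : ℤ) : ℝ) + (((e m).2 : ℝ) + 1) / (((e m).1 + 1 : ℕ) : ℝ) else a m
  have hmem : ∀ m ξ, ξ ∈ Set.Ico (a m) (b m) → (e m).2 < (e m).1 + 1 ∧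
      (10 * (e m).1 : ℝ) ≤ ξ ∧ ξ < 10 * (e m).1 + 1 ∧
      ((e m).2 : ℝ) ≤ (ξ - 10 * (e m).1) * (((e m).1 + 1 : ℕ) : ℝ) ∧
      (ξ - 10 * (e m).1) * (((e m).1 + 1 : ℕ) : ℝ) < (e m).2 + 1 := by
    intro m ξ hξ
    by_cases h : (e m).2 < (e m).1 + 1
    · simp only [a, b, if_pos h] at hξ
      obtain ⟨h1, h2⟩ := hξ
      have hM : (0 : ℝ) < (((e m).1 + 1 : ℕ) : ℝ) := by positivity
      have h3 : ((e m).2 : ℝ) / (((e m).1 + 1 : ℕ) : ℝ) ≤ ξ - 10 * (e m).1 := by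
        push_cast at h1 ⊢; linarith
      have h4 : ξ - 10 * (e m).1 < (((e m).2 : ℝ) + 1) / (((e m).1 + 1 : ℕ) : ℝ) := by
        push_cast at h2 ⊢; linarith
      have h5 : (0 : ℝ) ≤ ((e m).2 : ℝ) / (((e m).1 + 1 : ℕ) : ℝ) := by positivity
      have h6 : (((e m).2 : ℝ) + 1) / (((e m).1 + 1 : ℕ) : ℝ) ≤ 1 := by
        rw [div_le_one hM]; exact_mod_cast h
      rw [div_le_iff₀ hM] at h3
      have h4' := h4
      rw [lt_div_iff₀ hM] at h4
      refine ⟨h, ?_, by linarith, h3, h4⟩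
      push_cast at h1 h5
      linarith
    · simp only [b, if_neg h, Set.Ico_self, Set.mem_empty_iff_false] at hξ
  refine ⟨a, b, ?_, ?_⟩
  · intro m n hmn
    rw [Set.disjoint_left]
    intro ξ h1 h2
    obtain ⟨-, a1, a2, a3, a4⟩ := hmem m ξ h1
    obtain ⟨-, b1, b2, b3, b4⟩ := hmem n ξ h2
    have c1 : 10 * (e m).1 < 10 * (e n).1 + 1 := by
      have : (10 * (e m).1 : ℝ) < 10 * (e n).1 + 1 := by linarith
      exact_mod_cast this
    have c2 : 10 * (e n).1 < 10 * (e m).1 + 1 := by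
      have : (10 * (e n).1 : ℝ) < 10 * (e m).1 + 1 := by linarith
      exact_mod_cast this
    have c3 : (e m).1 = (e n).1 := by omega
    rw [c3] at a3 a4
    have c4 : (e m).2 < (e n).2 + 1 := by
      have : ((e m).2 : ℝ) < (e n).2 + 1 := by linarith
      exact_mod_cast this
    have c5 : (e n).2 < (e m).2 + 1 := by
      have : ((e n).2 : ℝ) < (e m).2 + 1 := by linarith
      exact_mod_cast this
    exact hmn (e.injective (Prod.ext c3 (by omega)))
  · rintro ⟨D, hD⟩
    have key : ∀ n : ℕ, 1 / (3 * Real.sqrt ((n + 1 : ℕ) : ℝ)) *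
        (2 * δ * ((n + 1 : ℕ) : ℝ)) ^ (1 / p.toReal) ≤ 2 * (D * R) := by
      intro n
      obtain ⟨f, hf⟩ := exists_test Λ hΛ hΛ0 (10 * n : ℤ) (n + 1)
      have hlow := lhs_lower φ hsupp hsum p q hp1' hpt hq Λ hΛ1 δ hδ hw (10 * n : ℤ) (n + 1)
        (Nat.succ_pos n) f hf a b (fun j => e.symm (n, j))
        (fun i j h => by simpa using h)
        (fun j hj => by simp [a]) (fun j hj => by
          have hj' : j ≤ n := by omega
          simp [b, hj']) (by
          intro m hm ξ hξ
          obtain ⟨h1, h2, h3, -, -⟩ := hmem m ξ hξ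
          have hne : (e m).1 ≠ n := by
            intro h
            apply hm (e m).2 (by omega)
            rw [Equiv.eq_symm_apply]
            exact Prod.ext h rfl
          rw [hf]
          simp only
          rw [hΛ0, zero_mul]
          rw [le_abs]
          push_cast
          rcases lt_or_gt_of_ne hne with h | h
          · right
            have : ((e m).1 : ℝ) + 1 ≤ n := by exact_mod_cast h
            linarith
          · left
            have : (n : ℝ) + 1 ≤ (e m).1 := by exact_mod_cast h
            linarith)
      have h2 := (hD f).trans (mul_le_mul_right (hR _ _ f hf) (D : ℝ≥0∞))
      have h3 := hlow.trans (mul_le_mul_right h2 (2 : ℝ≥0∞))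
      have h4 : (2 : ℝ≥0∞) * (D * R) = ENNReal.ofReal (2 * (D * R)) := by
        rw [ENNReal.ofReal_mul (by norm_num), ENNReal.ofReal_mul (by positivity)]
        simp
      rw [h4] at h3
      exact (ENNReal.ofReal_le_ofReal_iff (by positivity)).1 h3
    have hpr1 : 1 < p.toReal := by
      rw [← ENNReal.toReal_one]; exact (ENNReal.toReal_lt_toReal (by simp) hpt).2 hp1
    have hpr2 : p.toReal < 2 := by
      have := (ENNReal.toReal_lt_toReal hpt (by simp)).2 hp2
      simpa using this
    have hexp : 0 < 1 / p.toReal - 1 / 2 := by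
      rw [sub_pos]; exact one_div_lt_one_div_of_lt (by linarith) hpr2
    have hC : 0 < 1 / 3 * (2 * δ) ^ (1 / p.toReal) := by positivity
    have ht : Filter.Tendsto (fun n : ℕ => 1 / 3 * (2 * δ) ^ (1 / p.toReal) *
        (((n + 1 : ℕ) : ℝ)) ^ (1 / p.toReal - 1 / 2)) Filter.atTop Filter.atTop := by
      refine Filter.Tendsto.const_mul_atTop hC ?_
      exact (tendsto_rpow_atTop hexp).comp
        (tendsto_natCast_atTop_atTop.comp (Filter.tendsto_add_atTop_nat 1))
    obtain ⟨n, hn⟩ := (ht.eventually_gt_atTop (2 * (D * R : ℝ))).exists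
    refine absurd (key n) (not_le.2 (lt_of_lt_of_eq hn ?_))
    have hM : (0 : ℝ) < ((n + 1 : ℕ) : ℝ) := by positivity
    rw [Real.rpow_sub hM, Real.mul_rpow (by positivity) hM.le, Real.sqrt_eq_rpow]
    field_simp
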